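/- arXiv:2007.08735 — 2 statements merged into one kernel-verified Lean document; each statement's English description precedes it below -/
import Mathlib

section
/- Let 𝒞 be a finite set of classes with |𝒞| ≥ K ≥ 2 and let C : 𝒞 → 𝒞 → ℝ be a symmetric function taking strictly positive values on distinct pairs. Define, for each K-element subset S ⊆ 𝒞, the class-pair weight w_CP(S) = ∏_{{i,j} ⊆ S, i ≠ j} C(i,j), and the greedy weight w_GCP(S) obtained by enumerating S in any order c₁, …, c_K as C(c₁,c₂) · ∏_{k=2}^{K-1} ∏_{j=1}^{k} C(c_{k+1}, c_j). Then the probability distribution over K-element subsets obtained by normalizing w_GCP (i.e., assigning S the probability w_GCP(S) / ∑_{S'} w_GCP(S'), where the sum is over all K-element subsets S' of 𝒞) coincides with the distribution obtained by normalizing w_CP. -/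
/-!
STATEMENT 3 (Proposition 1, distributional form): normalizing the greedy
class-pair weights over all `K`-element category sets yields exactly the same
probability distribution as normalizing the full class-pair weights.
-/

/-- The class-pair weight `w_CP(s)`: the product of the potential `C`
over all unordered pairs of distinct elements of `s`. -/
noncomputable def pairWeight {α : Type*} [DecidableEq α]
    (C : α → α → ℝ) (hsym : ∀ a b, C a b = C b a) (s : Finset α) : ℝ :=
  ∏ p ∈ s.sym2.filter (fun p => ¬ p.IsDiag), Sym2.lift ⟨C, hsym⟩ p

/-- The greedy class-pair weight of a list `l = [c₁, …, c_K]` of classes,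
built sequentially: `C(c₁,c₂) · ∏_{k=2}^{K-1} ∏_{j=1}^{k} C(c_{k+1}, c_j)`
(0-indexed below). -/
noncomputable def greedyWeight {α : Type*} [Inhabited α]
    (C : α → α → ℝ) (l : List α) : ℝ :=
  ∏ k ∈ Finset.range (l.length - 1), ∏ j ∈ Finset.range (k + 1),
    C (l.getD (k + 1) default) (l.getD j default)

/-- The greedy class-pair weight `w_GCP(S)` of a `K`-element category set `S`,
obtained by enumerating `S` in some order. -/
noncomputable def gcpWeight {α : Type*} [DecidableEq α] [Inhabited α]
    (C : α → α → ℝ) (S : Finset α) : ℝ :=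
  greedyWeight C S.toList

theorem pairWeight_insert {α : Type*} [DecidableEq α]
    (C : α → α → ℝ) (hsym : ∀ a b, C a b = C b a) {a : α} {s : Finset α} (ha : a ∉ s) :
    pairWeight C hsym (insert a s) = pairWeight C hsym s * ∏ b ∈ s, C a b := by
  have hdisj : Disjoint (s.sym2.filter fun p => ¬ p.IsDiag) (s.image fun b => s(a, b)) := by
    rw [Finset.disjoint_left]
    intro p hp hp'
    obtain ⟨b, -, rfl⟩ := Finset.mem_image.1 hp'
    exact ha (Finset.mk_mem_sym2_iff.1 (Finset.mem_filter.1 hp).1).1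
  have heq : (insert a s).sym2.filter (fun p => ¬ p.IsDiag) =
      (s.sym2.filter fun p => ¬ p.IsDiag) ∪ s.image fun b => s(a, b) := by
    ext p
    induction p using Sym2.ind with
    | h x y =>
      simp only [Finset.mem_filter, Finset.mk_mem_sym2_iff, Finset.mem_insert,
        Finset.mem_union, Finset.mem_image, Sym2.mk_isDiag_iff, Sym2.eq_iff]
      grind
  rw [pairWeight, heq, Finset.prod_union hdisj, Finset.prod_image]
  · rfl
  · intro x _ y _ h
    exact Sym2.congr_right.1 h

theorem prod_range_length_getD {α M : Type*} [CommMonoid M] (f : α → M) (d : α) (l : List α) :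
    ∏ j ∈ Finset.range l.length, f (l.getD j d) = (l.map f).prod := by
  induction l with
  | nil => simp
  | cons a l ih => simp [Finset.prod_range_succ', ← ih, mul_comm]

theorem greedyWeight_concat {α : Type*} [Inhabited α] (C : α → α → ℝ) (l : List α) (a : α) :
    greedyWeight C (l ++ [a]) = greedyWeight C l * (l.map (C a)).prod := by
  rcases Nat.eq_zero_or_pos l.length with h | h
  · simp [List.length_eq_zero_iff.1 h, greedyWeight]
  obtain ⟨n, hn⟩ := Nat.exists_eq_add_of_lt h
  simp only [zero_add] at hn
  have hlt (j : ℕ) (hj : j < l.length) : (l ++ [a]).getD j default = l.getD j default :=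
    List.getD_append _ _ _ _ hj
  have hlast : (l ++ [a]).getD (n + 1) default = a := by
    rw [List.getD_append_right _ _ _ _ hn.le]
    simp [hn]
  rw [← prod_range_length_getD (C a) default l]
  simp only [greedyWeight, List.length_append, List.length_singleton, hn, Nat.add_sub_cancel]
  rw [Finset.prod_range_succ, hlast]
  congr 1
  · refine Finset.prod_congr rfl fun k hk => Finset.prod_congr rfl fun j hj => ?_
    rw [Finset.mem_range] at hk hj
    rw [hlt _ (by omega), hlt _ (by omega)]
  · refine Finset.prod_congr rfl fun j hj => ?_
    rw [Finset.mem_range] at hj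
    rw [hlt _ (by omega)]

theorem greedyWeight_eq_pairWeight_toFinset {α : Type*} [DecidableEq α] [Inhabited α]
    (C : α → α → ℝ) (hsym : ∀ a b, C a b = C b a) {l : List α} (hl : l.Nodup) :
    greedyWeight C l = pairWeight C hsym l.toFinset := by
  induction l using List.reverseRecOn with
  | nil => simp [greedyWeight, pairWeight]
  | append_singleton l a ih =>
    have hl' : l.Nodup := hl.of_append_left
    have ha : a ∉ l.toFinset := by
      rw [List.mem_toFinset]
      exact fun h => (List.nodup_append.1 hl).2.2 a h a (List.mem_singleton_self a) rfl
    have hins : (l ++ [a]).toFinset = insert a l.toFinset := by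
      ext x
      simp
    rw [hins, pairWeight_insert C hsym ha, greedyWeight_concat, ih hl',
      List.prod_toFinset _ hl']

theorem gcpWeight_eq_pairWeight {α : Type*} [DecidableEq α] [Inhabited α]
    (C : α → α → ℝ) (hsym : ∀ a b, C a b = C b a) (S : Finset α) :
    gcpWeight C S = pairWeight C hsym S := by
  rw [gcpWeight, greedyWeight_eq_pairWeight_toFinset C hsym S.nodup_toList, Finset.toList_toFinset]

/-- For a finite class set `𝒞 = univ` with `|𝒞| ≥ K ≥ 2` and a symmetric
potential `C` that is strictly positive on distinct pairs, the probability
distribution over `K`-element subsets obtained by normalizing the greedy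
weights `w_GCP` coincides with the one obtained by normalizing the class-pair
weights `w_CP`. -/
theorem gcp_distribution_eq_cp_distribution
    {α : Type*} [Fintype α] [DecidableEq α] [Inhabited α]
    (C : α → α → ℝ) (hsym : ∀ a b, C a b = C b a)
    (hpos : ∀ i j, i ≠ j → 0 < C i j)
    (K : ℕ) (hK : 2 ≤ K) (hcard : K ≤ Fintype.card α)
    (S : Finset α) (hS : S.card = K) :
    gcpWeight C S / (∑ S' ∈ Finset.powersetCard K (Finset.univ : Finset α), gcpWeight C S')
      = pairWeight C hsym S /
        (∑ S' ∈ Finset.powersetCard K (Finset.univ : Finset α), pairWeight C hsym S') := by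
  simp only [gcpWeight_eq_pairWeight C hsym]
end

section
/- Let Σ be a finite (nonempty) hypothesis space and (Z, μ) a probability space of data points. Let ℓ : Σ × Z → [0,1] be a measurable loss function. Fix a sample size n ≥ 1 and draw z₁, …, z_n i.i.d. from μ. Let P be a fixed (prior) probability distribution on Σ. Then for any δ ∈ (0,1] and any real number c > 0, with probability at least 1 − δ over the draw of the sample, the following inequality holds simultaneously for all (posterior) probability distributions Q on Σ that are absolutely continuous with respect to P: E_{θ∼Q}[ E_{z∼μ} ℓ(θ, z) ] ≤ (c / (1 − e^{−c})) · ( E_{θ∼Q}[ (1/n) ∑_{i=1}^{n} ℓ(θ, z_i) ] + ( KL(Q ‖ P) + log(1/δ) ) / (n c) ), where KL(Q ‖ P) = ∑_{θ ∈ Σ} Q(θ) log( Q(θ) / P(θ) ) is the Kullback–Leibler divergence from Q to P. -/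
open MeasureTheory

/-- The chord bound for the exponential function on the unit interval. -/
lemma exp_neg_mul_le_one_sub (c x : ℝ) (hx : x ∈ Set.Icc (0 : ℝ) 1) :
    Real.exp (-c * x) ≤ 1 - (1 - Real.exp (-c)) * x := by
  have h := convexOn_exp.2 (Set.mem_univ (0 : ℝ)) (Set.mem_univ (-c))
    (sub_nonneg.2 hx.2) hx.1 (by ring)
  simp only [smul_eq_mul, mul_zero, zero_add, Real.exp_zero, mul_one] at h
  rw [mul_comm x (-c)] at h
  linarith

/-- The Laplace transform of a `[0,1]`-valued random variable. -/
lemma integral_exp_neg_mul_le {Z : Type*} [MeasurableSpace Z] (μ : Measure Z)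
    [IsProbabilityMeasure μ] (f : Z → ℝ) (hf : Measurable f)
    (hb : ∀ z, f z ∈ Set.Icc (0 : ℝ) 1) (c : ℝ) (hc : 0 < c) :
    Integrable (fun z => Real.exp (-c * f z)) μ ∧
      ∫ z, Real.exp (-c * f z) ∂μ ≤ Real.exp (-((1 - Real.exp (-c)) * ∫ z, f z ∂μ)) := by
  have hfi : Integrable f μ := by
    refine Integrable.of_bound hf.aestronglyMeasurable 1 (ae_of_all _ fun z => ?_)
    rw [Real.norm_eq_abs, abs_of_nonneg (hb z).1]
    exact (hb z).2
  have hei : Integrable (fun z => Real.exp (-c * f z)) μ := by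
    refine Integrable.of_bound (by fun_prop) 1 (ae_of_all _ fun z => ?_)
    rw [Real.norm_eq_abs, Real.abs_exp, Real.exp_le_one_iff]
    nlinarith [(hb z).1]
  refine ⟨hei, ?_⟩
  calc ∫ z, Real.exp (-c * f z) ∂μ
      ≤ ∫ z, (1 - (1 - Real.exp (-c)) * f z) ∂μ :=
        integral_mono hei ((integrable_const 1).sub (hfi.const_mul _))
          fun z => exp_neg_mul_le_one_sub c _ (hb z)
    _ = 1 - (1 - Real.exp (-c)) * ∫ z, f z ∂μ := by
        rw [integral_sub (integrable_const 1) (hfi.const_mul _), integral_const_mul]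
        simp
    _ ≤ _ := by
        have := Real.add_one_le_exp (-((1 - Real.exp (-c)) * ∫ z, f z ∂μ))
        linarith

/-- The exponential moment of the deviation of an i.i.d. sum is at most one. -/
lemma integral_pi_exp_sub_le_one {Z : Type*} [MeasurableSpace Z] (μ : Measure Z)
    [IsProbabilityMeasure μ] (f : Z → ℝ) (hf : Measurable f)
    (hb : ∀ z, f z ∈ Set.Icc (0 : ℝ) 1) (c : ℝ) (hc : 0 < c) (n : ℕ) :
    Integrable (fun z : Fin n → Z =>
        Real.exp (n * ((1 - Real.exp (-c)) * ∫ x, f x ∂μ) - c * ∑ i, f (z i)))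
        (Measure.pi fun _ => μ) ∧
      ∫ z : Fin n → Z,
        Real.exp (n * ((1 - Real.exp (-c)) * ∫ x, f x ∂μ) - c * ∑ i, f (z i))
        ∂(Measure.pi fun _ => μ) ≤ 1 := by
  obtain ⟨hi, hle⟩ := integral_exp_neg_mul_le μ f hf hb c hc
  set r := (1 - Real.exp (-c)) * ∫ x, f x ∂μ
  have heq : (fun z : Fin n → Z => Real.exp (n * r - c * ∑ i, f (z i))) =
      fun z => Real.exp (n * r) * ∏ i, Real.exp (-c * f (z i)) := by
    funext z
    rw [← Real.exp_sum, ← Real.exp_add, ← Finset.mul_sum]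
    congr 1
    ring
  rw [heq]
  refine ⟨(Integrable.fintype_prod fun _ => hi).const_mul _, ?_⟩
  rw [integral_const_mul, integral_fintype_prod_eq_pow fun z => Real.exp (-c * f z),
    Fintype.card_fin]
  calc Real.exp (n * r) * (∫ z, Real.exp (-c * f z) ∂μ) ^ n
      ≤ Real.exp (n * r) * Real.exp (-r) ^ n := by
        have : 0 ≤ ∫ z, Real.exp (-c * f z) ∂μ := integral_nonneg fun z => (Real.exp_pos _).le
        gcongr
    _ = 1 := by
        rw [← Real.exp_nat_mul, ← Real.exp_add]
        simp

/-- The Donsker–Varadhan change-of-measure inequality on a finite type. -/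
lemma sum_mul_le_sum_mul_log_div_add {H : Type*} [Fintype H] (P Q f : H → ℝ) (L : ℝ)
    (hP0 : ∀ θ, 0 ≤ P θ) (hQ0 : ∀ θ, 0 ≤ Q θ) (hQ1 : ∑ θ, Q θ = 1)
    (hQP : ∀ θ, P θ = 0 → Q θ = 0) (hL : ∑ θ, P θ * Real.exp (f θ) ≤ Real.exp L) :
    ∑ θ, Q θ * f θ ≤ (∑ θ, Q θ * Real.log (Q θ / P θ)) + L := by
  have key : ∀ θ, Q θ * f θ - Q θ * Real.log (Q θ / P θ) - Q θ * L ≤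
      P θ * Real.exp (f θ) * Real.exp (-L) - Q θ := by
    intro θ
    rcases (hQ0 θ).eq_or_lt with h | h
    · simp only [← h, zero_mul, sub_zero]
      have := hP0 θ
      positivity
    · have hP : 0 < P θ := (hP0 θ).lt_of_ne fun h0 => h.ne' (hQP θ h0.symm)
      have hx := Real.add_one_le_exp (f θ - Real.log (Q θ / P θ) - L)
      have he : Real.exp (f θ - Real.log (Q θ / P θ) - L) =
          P θ / Q θ * Real.exp (f θ) * Real.exp (-L) := by
        rw [sub_eq_add_neg _ L, Real.exp_add, Real.exp_sub, Real.exp_log (by positivity)]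
        field_simp
      rw [he] at hx
      have hm := mul_le_mul_of_nonneg_left hx h.le
      have hq : Q θ * (P θ / Q θ * Real.exp (f θ) * Real.exp (-L)) =
          P θ * Real.exp (f θ) * Real.exp (-L) := by
        field_simp
      rw [hq] at hm
      linarith
  have hs := Finset.sum_le_sum fun θ (_ : θ ∈ Finset.univ) => key θ
  simp only [Finset.sum_sub_distrib, ← Finset.sum_mul, hQ1] at hs
  have hm := mul_le_mul_of_nonneg_right hL (Real.exp_pos (-L)).le
  rw [← Real.exp_add, add_neg_cancel, Real.exp_zero] at hm
  linarith

/-- Catoni's PAC-Bayes bound. Let `H` be a finite nonempty hypothesis space,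
`μ` a probability measure on data points `Z`, and `ℓ : H → Z → [0,1]` a
measurable loss. Fix `n ≥ 1`, a prior `P` on `H`, `δ ∈ (0,1]` and `c > 0`.
Then with probability at least `1 - δ` over an i.i.d. sample `z₁, …, z_n ∼ μ`
(i.e. a draw from the `n`-fold product measure), simultaneously for all
posteriors `Q` on `H` absolutely continuous w.r.t. `P`:
`er(Q) ≤ (c / (1 - e^{-c})) · (êr(Q) + (KL(Q‖P) + log(1/δ)) / (n c))`. -/
theorem catoni_pac_bayes_bound
    {H Z : Type*} [Fintype H] [Nonempty H] [MeasurableSpace Z]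
    (μ : Measure Z) [IsProbabilityMeasure μ]
    (ℓ : H → Z → ℝ) (hmeas : ∀ θ, Measurable (ℓ θ))
    (hbound : ∀ θ z, ℓ θ z ∈ Set.Icc (0 : ℝ) 1)
    (n : ℕ) (hn : 1 ≤ n)
    (P : H → ℝ) (hP0 : ∀ θ, 0 ≤ P θ) (hP1 : ∑ θ, P θ = 1)
    (δ : ℝ) (hδ : δ ∈ Set.Ioc (0 : ℝ) 1) (c : ℝ) (hc : 0 < c) :
    ENNReal.ofReal (1 - δ) ≤
      Measure.pi (fun _ : Fin n => μ)
        {z : Fin n → Z | ∀ Q : H → ℝ, (∀ θ, 0 ≤ Q θ) → (∑ θ, Q θ) = 1 →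
          (∀ θ, P θ = 0 → Q θ = 0) →
          (∑ θ, Q θ * ∫ x, ℓ θ x ∂μ) ≤
            (c / (1 - Real.exp (-c))) *
              ((∑ θ, Q θ * ((1 / (n : ℝ)) * ∑ i : Fin n, ℓ θ (z i))) +
                ((∑ θ, Q θ * Real.log (Q θ / P θ)) + Real.log (1 / δ)) /
                  ((n : ℝ) * c))} := by
  have ha : 0 < 1 - Real.exp (-c) := by
    rw [sub_pos, Real.exp_lt_one_iff]
    linarith
  have hn0 : (0 : ℝ) < n := by exact_mod_cast hn
  set g : H → (Fin n → Z) → ℝ := fun θ z =>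
    n * ((1 - Real.exp (-c)) * ∫ x, ℓ θ x ∂μ) - c * ∑ i, ℓ θ (z i) with hg
  set W : (Fin n → Z) → ℝ := fun z => ∑ θ, P θ * Real.exp (g θ z) with hW
  have hexp := fun θ => integral_pi_exp_sub_le_one μ (ℓ θ) (hmeas θ) (hbound θ) c hc n
  have hWi : Integrable W (Measure.pi fun _ => μ) :=
    integrable_finsetSum _ fun θ _ => (hexp θ).1.const_mul _
  have hWle : ∫ z, W z ∂(Measure.pi fun _ => μ) ≤ 1 := by
    rw [hW, integral_finsetSum _ fun θ _ => (hexp θ).1.const_mul _]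
    refine (Finset.sum_le_sum fun θ _ => ?_).trans_eq hP1
    rw [integral_const_mul]
    exact mul_le_of_le_one_right (hP0 θ) (hexp θ).2
  have hWm : Measurable W := by
    refine Finset.measurable_sum _ fun θ _ => ?_
    have hS : Measurable fun z : Fin n → Z => ∑ i, ℓ θ (z i) :=
      Finset.measurable_sum _ fun i _ => (hmeas θ).comp (measurable_pi_apply i)
    fun_prop
  have hW0 : ∀ z, 0 ≤ W z := fun z =>
    Finset.sum_nonneg fun θ _ => mul_nonneg (hP0 θ) (Real.exp_pos _).le
  have hmarkov := mul_meas_ge_le_integral_of_nonneg (ae_of_all _ hW0) hWi (1 / δ)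
  have hbad : (Measure.pi fun _ : Fin n => μ).real {z | 1 / δ ≤ W z} ≤ δ := by
    have h := hmarkov.trans hWle
    rwa [one_div_mul_eq_div, div_le_one hδ.1] at h
  have hms : MeasurableSet {z | 1 / δ ≤ W z} := measurableSet_le measurable_const hWm
  have hgood : ENNReal.ofReal (1 - δ) ≤
      (Measure.pi fun _ : Fin n => μ) {z | 1 / δ ≤ W z}ᶜ := by
    rw [← ofReal_measureReal, probReal_compl_eq_one_sub hms]
    exact ENNReal.ofReal_le_ofReal (by linarith)
  refine hgood.trans (measure_mono fun z hz Q hQ0 hQ1 hQP => ?_)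
  have hz' : W z ≤ Real.exp (Real.log (1 / δ)) := by
    rw [Real.exp_log (one_div_pos.2 hδ.1)]
    exact le_of_not_ge fun h => hz h
  have hDV := sum_mul_le_sum_mul_log_div_add P Q (fun θ => g θ z) _ hP0 hQ0 hQ1 hQP hz'
  have hsplit : ∑ θ, Q θ * g θ z = n * (1 - Real.exp (-c)) * (∑ θ, Q θ * ∫ x, ℓ θ x ∂μ) -
      c * n * ∑ θ, Q θ * ((1 / (n : ℝ)) * ∑ i, ℓ θ (z i)) := by
    rw [Finset.mul_sum, Finset.mul_sum, ← Finset.sum_sub_distrib]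
    refine Finset.sum_congr rfl fun θ _ => ?_
    simp only [hg]
    field_simp
  rw [hsplit] at hDV
  generalize (∑ θ, Q θ * ∫ x, ℓ θ x ∂μ) = R at *
  generalize (∑ θ, Q θ * ((1 / (n : ℝ)) * ∑ i, ℓ θ (z i))) = E at *
  generalize (∑ θ, Q θ * Real.log (Q θ / P θ)) + Real.log (1 / δ) = K at *
  have hrhs : c / (1 - Real.exp (-c)) * (E + K / (n * c)) =
      (c * n * E + K) / (n * (1 - Real.exp (-c))) := by
    field_simp
  rw [hrhs, le_div_iff₀ (by positivity)]
  linarith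
end
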